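/- Let u(x,y,t) = x − 3yt − 2x³ and define I(r) = r^{-2} ∫_{B^{ℍ¹}_r(0)} |∇_{ℍ¹}u(ξ)|² / |ξ|²_{ℍ¹} dξ, where B^{ℍ¹}_r(0) is the Koranyi ball of radius r. Then there exist constants a₁ > 0, c > 0, a₃ ≥ 0 such that I(r) = a₁ − 2c r² + a₃ r⁴ for all r > 0; in particular, I is strictly monotone decreasing on a right neighborhood of r = 0. -/

import Mathlib

open MeasureTheory

/-- The Koranyi gauge on ℍ¹ = ℝ³. -/
noncomputable def koranyi (ξ : ℝ × ℝ × ℝ) : ℝ :=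
  ((ξ.1 ^ 2 + ξ.2.1 ^ 2) ^ 2 + ξ.2.2 ^ 2) ^ ((1 : ℝ) / 4)

/-- The Koranyi ball of radius r centered at 0. -/
def koranyiBall (r : ℝ) : Set (ℝ × ℝ × ℝ) := {ξ | koranyi ξ < r}

/-- |∇_{ℍ¹}u|² = (1−6(x²+y²))² + 9(−t+2xy)² for u = x − 3yt − 2x³. -/
def gradSq (ξ : ℝ × ℝ × ℝ) : ℝ :=
  (1 - 6 * (ξ.1 ^ 2 + ξ.2.1 ^ 2)) ^ 2 + 9 * (-ξ.2.2 + 2 * ξ.1 * ξ.2.1) ^ 2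

/-- I(r) = r⁻² ∫_{B^{ℍ¹}_r(0)} |∇_{ℍ¹}u(ξ)|²/|ξ|²_{ℍ¹} dξ for u = x − 3yt − 2x³. -/
noncomputable def Ifun (r : ℝ) : ℝ :=
  (1 / r ^ 2) * ∫ ξ in koranyiBall r, gradSq ξ / (koranyi ξ) ^ 2

lemma absrpow_integrable (a : ℝ) (ha : -1 < a) :
    Integrable (Set.indicator (Set.Icc (-1:ℝ) 1) (fun x : ℝ => |x| ^ a)) := by
  rw [integrable_indicator_iff measurableSet_Icc]
  rw [← intervalIntegrable_iff_integrableOn_Icc_of_le (by norm_num)]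
  have h1 : IntervalIntegrable (fun x : ℝ => |x| ^ a) volume 0 1 := by
    refine (intervalIntegral.intervalIntegrable_rpow' (a := 0) (b := 1) ha).congr ?_
    intro x hx
    rw [Set.uIoc_of_le (by norm_num)] at hx
    simp only [abs_of_pos hx.1]
  have h2 : IntervalIntegrable (fun x : ℝ => |x| ^ a) volume (-1) 0 := by
    rw [IntervalIntegrable.iff_comp_neg]
    simpa using h1.symm
  exact h2.trans h1

lemma koranyi_nonneg (ξ : ℝ × ℝ × ℝ) : 0 ≤ koranyi ξ := by
  unfold koranyi; positivity

lemma koranyi_pow_four (ξ : ℝ × ℝ × ℝ) :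
    koranyi ξ ^ 4 = (ξ.1 ^ 2 + ξ.2.1 ^ 2) ^ 2 + ξ.2.2 ^ 2 := by
  unfold koranyi
  rw [← Real.rpow_natCast, ← Real.rpow_mul (by positivity)]
  norm_num

lemma koranyi_continuous : Continuous koranyi := by
  unfold koranyi
  refine Continuous.rpow_const (by fun_prop) ?_
  intro x; right; norm_num

lemma rho_le (ξ : ℝ × ℝ × ℝ) : ξ.1 ^ 2 + ξ.2.1 ^ 2 ≤ koranyi ξ ^ 2 := by
  refine abs_le_of_sq_le_sq' ?_ (by positivity) |>.2
  have := koranyi_pow_four ξ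
  nlinarith [sq_nonneg ξ.2.2]

lemma abs_fst_le (ξ : ℝ × ℝ × ℝ) : |ξ.1| ≤ koranyi ξ := by
  refine abs_le_of_sq_le_sq ?_ (koranyi_nonneg ξ)
  nlinarith [rho_le ξ, sq_nonneg ξ.2.1]

lemma abs_snd_le (ξ : ℝ × ℝ × ℝ) : |ξ.2.1| ≤ koranyi ξ := by
  refine abs_le_of_sq_le_sq ?_ (koranyi_nonneg ξ)
  nlinarith [rho_le ξ, sq_nonneg ξ.1]

lemma abs_t_le (ξ : ℝ × ℝ × ℝ) : |ξ.2.2| ≤ koranyi ξ ^ 2 := by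
  refine abs_le_of_sq_le_sq ?_ (by positivity)
  have := koranyi_pow_four ξ
  nlinarith [sq_nonneg (ξ.1 ^ 2 + ξ.2.1 ^ 2)]

lemma isOpen_ball (r : ℝ) : IsOpen (koranyiBall r) :=
  isOpen_lt koranyi_continuous continuous_const

lemma pointwise_bound (k x t : ℝ) (hx : x ≠ 0) (ht : t ≠ 0) (h1 : |x| ≤ k) (h2 : |t| ≤ k ^ 2) :
    1 / k ^ 2 ≤ |x| ^ (-(1/2) : ℝ) * |t| ^ (-(3/4) : ℝ) := by
  have hx' : 0 < |x| := abs_pos.2 hx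
  have ht' : 0 < |t| := abs_pos.2 ht
  have hk : 0 < k := lt_of_lt_of_le hx' h1
  have e : 1 / k ^ 2 = k ^ (-(1/2) : ℝ) * (k ^ 2) ^ (-(3/4) : ℝ) := by
    rw [← Real.rpow_natCast, ← Real.rpow_mul hk.le, ← Real.rpow_add hk, one_div,
      ← Real.rpow_neg hk.le]
    norm_num
  rw [e]
  gcongr ?_ * ?_
  · exact Real.rpow_le_rpow_of_nonpos hx' h1 (by norm_num)
  · exact Real.rpow_le_rpow_of_nonpos ht' h2 (by norm_num)

lemma inv_integrable : IntegrableOn (fun ξ => 1 / koranyi ξ ^ 2) (koranyiBall 1) := by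
  have hG := (absrpow_integrable (-(1/2)) (by norm_num)).mul_prod
    ((absrpow_integrable 0 (by norm_num)).mul_prod (absrpow_integrable (-(3/4)) (by norm_num)))
  have hG' := hG.integrableOn (s := koranyiBall 1)
  refine Integrable.mono' hG' ?_ ?_
  · exact ((measurable_const).div (koranyi_continuous.measurable.pow_const 2)).aestronglyMeasurable
  · have a0 : ∀ᵐ x : ℝ, x ≠ 0 := by simp [ae_iff]
    have a1 : ∀ᵐ ξ : ℝ × ℝ × ℝ, ξ.1 ≠ 0 := Measure.quasiMeasurePreserving_fst.ae a0
    have a2 : ∀ᵐ ξ : ℝ × ℝ × ℝ, ξ.2.2 ≠ 0 :=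
      Measure.quasiMeasurePreserving_snd.ae
        (Measure.quasiMeasurePreserving_snd.ae (p := fun x : ℝ => x ≠ 0) a0)
    filter_upwards [ae_restrict_of_ae a1, ae_restrict_of_ae a2,
      ae_restrict_mem (isOpen_ball 1).measurableSet] with ξ h1 h2 h3
    have hk : koranyi ξ < 1 := h3
    have hk0 := koranyi_nonneg ξ
    have m1 : ξ.1 ∈ Set.Icc (-1:ℝ) 1 := abs_le.1 ((abs_fst_le ξ).trans hk.le)
    have m2 : ξ.2.1 ∈ Set.Icc (-1:ℝ) 1 := abs_le.1 ((abs_snd_le ξ).trans hk.le)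
    have m3 : ξ.2.2 ∈ Set.Icc (-1:ℝ) 1 := abs_le.1 ((abs_t_le ξ).trans (by nlinarith))
    rw [Set.indicator_of_mem m1, Set.indicator_of_mem m2, Set.indicator_of_mem m3,
      Real.norm_of_nonneg (by positivity), Real.rpow_zero, one_mul]
    exact pointwise_bound _ _ _ h1 h2 (abs_fst_le ξ) (abs_t_le ξ)

lemma div_integrable (p : ℝ × ℝ × ℝ → ℝ) (hp : Continuous p) (C : ℝ)
    (hC : ∀ ξ ∈ koranyiBall 1, |p ξ| ≤ C) :
    IntegrableOn (fun ξ => p ξ / koranyi ξ ^ 2) (koranyiBall 1) := by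
  refine Integrable.mono' (inv_integrable.const_mul C) ?_ ?_
  · exact (hp.measurable.div (koranyi_continuous.measurable.pow_const 2)).aestronglyMeasurable
  · filter_upwards [ae_restrict_mem (isOpen_ball 1).measurableSet] with ξ h3
    rw [Real.norm_eq_abs, abs_div, abs_of_nonneg (sq_nonneg (koranyi ξ)), mul_one_div]
    have := hC ξ h3
    gcongr

lemma div_integral_pos (p : ℝ × ℝ × ℝ → ℝ) (hp : Continuous p) (C : ℝ)
    (hC : ∀ ξ ∈ koranyiBall 1, |p ξ| ≤ C) (h0 : ∀ ξ, 0 ≤ p ξ) (h1 : ∀ ξ, ξ.1 ≠ 0 → 0 < p ξ) :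
    0 < ∫ ξ in koranyiBall 1, p ξ / koranyi ξ ^ 2 := by
  rw [setIntegral_pos_iff_support_of_nonneg_ae
    (Filter.Eventually.of_forall fun ξ => div_nonneg (h0 ξ) (sq_nonneg _))
    (div_integrable p hp C hC)]
  have ho : IsOpen ({ξ : ℝ × ℝ × ℝ | ξ.1 ≠ 0} ∩ koranyiBall 1) :=
    (isOpen_ne_fun continuous_fst continuous_const).inter (isOpen_ball 1)
  refine lt_of_lt_of_le (ho.measure_pos volume ⟨(1/2, 0, 0), by norm_num, ?_⟩) (measure_mono ?_)
  · change koranyi _ < 1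
    refine lt_of_pow_lt_pow_left₀ 4 (by norm_num) ?_
    rw [koranyi_pow_four]; norm_num
  · intro ξ hξ
    refine ⟨?_, hξ.2⟩
    have : 0 < koranyi ξ := lt_of_lt_of_le (abs_pos.2 hξ.1) (abs_fst_le ξ)
    have := h1 ξ hξ.1
    simp only [Function.mem_support]
    positivity

lemma koranyi_dil (r : ℝ) (hr : 0 < r) (ξ : ℝ × ℝ × ℝ) :
    koranyi (r * ξ.1, r * ξ.2.1, r ^ 2 * ξ.2.2) = r * koranyi ξ := by
  refine (pow_left_inj₀ (koranyi_nonneg _) (mul_nonneg hr.le (koranyi_nonneg _)) (n := 4)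
    (by norm_num)).1 ?_
  rw [mul_pow, koranyi_pow_four, koranyi_pow_four]
  ring

/-- The Heisenberg dilation. -/
noncomputable def dil (r : ℝ) : (ℝ × ℝ × ℝ) →ₗ[ℝ] (ℝ × ℝ × ℝ) :=
  (r • LinearMap.id).prodMap ((r • LinearMap.id).prodMap ((r ^ 2) • LinearMap.id))

lemma dil_apply (r : ℝ) (ξ : ℝ × ℝ × ℝ) :
    dil r ξ = (r * ξ.1, r * ξ.2.1, r ^ 2 * ξ.2.2) := by
  simp [dil]

lemma dil_det (r : ℝ) : LinearMap.det (dil r) = r ^ 4 := by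
  simp [dil, LinearMap.det_prodMap]; ring

lemma integral_dil (r : ℝ) (hr : 0 < r) (F : ℝ × ℝ × ℝ → ℝ) :
    ∫ ξ in koranyiBall r, F ξ = r ^ 4 * ∫ ξ in koranyiBall 1, F (dil r ξ) := by
  have hd : LinearMap.det (dil r) ≠ 0 := by rw [dil_det]; positivity
  have h2 : Measure.IsAddHaarMeasure (volume : Measure (ℝ × ℝ)) :=
    Measure.prod.instIsAddHaarMeasure (volume : Measure ℝ) (volume : Measure ℝ)
  have h3 : Measure.IsAddHaarMeasure (volume : Measure (ℝ × ℝ × ℝ)) :=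
    Measure.prod.instIsAddHaarMeasure (volume : Measure ℝ) (volume : Measure (ℝ × ℝ))
  have hm := Measure.map_linearMap_addHaar_eq_smul_addHaar
    (volume : Measure (ℝ × ℝ × ℝ)) hd
  have hemb : MeasurableEmbedding (dil r) :=
    ((LinearEquiv.ofIsUnitDet (f := dil r) (v := Module.finBasis ℝ _) (v' := Module.finBasis ℝ _)
      (by rw [LinearMap.det_toMatrix]; exact hd.isUnit)).toContinuousLinearEquiv.toHomeomorph).measurableEmbedding
  have key := hemb.setIntegral_map (μ := volume) F (koranyiBall r)
  have hpre : dil r ⁻¹' koranyiBall r = koranyiBall 1 := by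
    ext ξ
    simp only [koranyiBall, Set.mem_preimage, Set.mem_ofPred_eq, dil_apply, koranyi_dil r hr]
    exact mul_lt_iff_lt_one_right hr
  rw [hm, hpre, dil_det, Measure.restrict_smul, integral_smul_measure,
    ENNReal.toReal_ofReal (abs_nonneg _), abs_of_pos (by positivity)] at key
  rw [← key, smul_eq_mul, ← mul_assoc, mul_inv_cancel₀ (by positivity), one_mul]

lemma Ifun_formula (r : ℝ) (hr : 0 < r) :
    Ifun r = (∫ ξ in koranyiBall 1, 1 / koranyi ξ ^ 2)
      - 12 * r ^ 2 * (∫ ξ in koranyiBall 1, (ξ.1 ^ 2 + ξ.2.1 ^ 2) / koranyi ξ ^ 2)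
      + r ^ 4 * ∫ ξ in koranyiBall 1, (36 * (ξ.1 ^ 2 + ξ.2.1 ^ 2) ^ 2
          + 9 * (-ξ.2.2 + 2 * ξ.1 * ξ.2.1) ^ 2) / koranyi ξ ^ 2 := by
  have i1 := inv_integrable
  have i2 := div_integrable (fun ξ => ξ.1 ^ 2 + ξ.2.1 ^ 2) (by fun_prop) 1 (by
    intro ξ hξ
    have hk : koranyi ξ < 1 := hξ
    rw [abs_of_nonneg (by positivity)]
    nlinarith [rho_le ξ, koranyi_nonneg ξ])
  have i3 := div_integrable (fun ξ => 36 * (ξ.1 ^ 2 + ξ.2.1 ^ 2) ^ 2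
          + 9 * (-ξ.2.2 + 2 * ξ.1 * ξ.2.1) ^ 2) (by fun_prop) 72 (by
    intro ξ hξ
    have hk : koranyi ξ < 1 := hξ
    have hk0 := koranyi_nonneg ξ
    have hk2 : koranyi ξ ^ 2 ≤ 1 := by nlinarith
    rw [abs_of_nonneg (by positivity)]
    have h1 : ξ.1 ^ 2 + ξ.2.1 ^ 2 ≤ 1 := (rho_le ξ).trans hk2
    have h2 := abs_le.1 ((abs_t_le ξ).trans hk2)
    have h3 : (ξ.1 ^ 2 + ξ.2.1 ^ 2) ^ 2 ≤ 1 := pow_le_one₀ (by positivity) h1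
    have h4 : |-ξ.2.2 + 2 * ξ.1 * ξ.2.1| ≤ 2 := by
      rw [abs_le]; constructor <;> nlinarith [sq_nonneg (ξ.1 - ξ.2.1), sq_nonneg (ξ.1 + ξ.2.1)]
    have h5 : (-ξ.2.2 + 2 * ξ.1 * ξ.2.1) ^ 2 ≤ 2 ^ 2 := sq_le_sq' (abs_le.1 h4).1 (abs_le.1 h4).2
    linarith)
  unfold Ifun
  rw [integral_dil r hr, ← integral_const_mul, ← integral_const_mul (1 / r ^ 2),
    ← integral_const_mul (12 * r ^ 2),
    ← integral_sub i1 (i2.const_mul _), ← integral_const_mul (r ^ 4)]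
  refine Eq.trans ?_ (integral_add (i1.sub (i2.const_mul (12 * r ^ 2))) (i3.const_mul (r ^ 4)))
  congr 1
  funext ξ
  rw [dil_apply, koranyi_dil r hr]
  simp only [gradSq, Pi.sub_apply]
  by_cases h : koranyi ξ = 0
  · simp [h]
  · field_simp
    ring

/-- For u = x − 3yt − 2x³, the function I(r) has the explicit form a₁ − 2c r² + a₃ r⁴ with
    a₁, c > 0, a₃ ≥ 0; in particular it is strictly decreasing near r = 0. -/
theorem Ifun_strictly_decreasing :
    (∃ a₁ c a₃ : ℝ, 0 < a₁ ∧ 0 < c ∧ 0 ≤ a₃ ∧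
      ∀ r : ℝ, 0 < r → Ifun r = a₁ - 2 * c * r ^ 2 + a₃ * r ^ 4) ∧
    ∃ ε : ℝ, 0 < ε ∧ StrictAntiOn Ifun (Set.Ioo 0 ε) := by
  set A := ∫ ξ in koranyiBall 1, 1 / koranyi ξ ^ 2 with hA
  set B := ∫ ξ in koranyiBall 1, (ξ.1 ^ 2 + ξ.2.1 ^ 2) / koranyi ξ ^ 2 with hB
  set C := ∫ ξ in koranyiBall 1, (36 * (ξ.1 ^ 2 + ξ.2.1 ^ 2) ^ 2
          + 9 * (-ξ.2.2 + 2 * ξ.1 * ξ.2.1) ^ 2) / koranyi ξ ^ 2 with hCdef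
  have hA0 : 0 < A := div_integral_pos (fun _ => 1) continuous_const 1 (by simp) (by simp)
    (by simp)
  have hB0 : 0 < B := div_integral_pos (fun ξ => ξ.1 ^ 2 + ξ.2.1 ^ 2) (by fun_prop) 1 (by
      intro ξ hξ
      have hk : koranyi ξ < 1 := hξ
      rw [abs_of_nonneg (by positivity)]
      nlinarith [rho_le ξ, koranyi_nonneg ξ]) (fun ξ => by positivity)
      (fun ξ h => by positivity)
  have hC0 : 0 ≤ C := integral_nonneg fun ξ => by positivity
  have hI : ∀ r : ℝ, 0 < r → Ifun r = A - 2 * (6 * B) * r ^ 2 + C * r ^ 4 := by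
    intro r hr
    rw [Ifun_formula r hr, ← hA, ← hB, ← hCdef]; ring
  clear_value A B C
  refine ⟨⟨A, 6 * B, C, hA0, by positivity, hC0, hI⟩,
    Real.sqrt (6 * B / (C + 1)), by positivity, ?_⟩
  intro r hr s hs hrs
  rw [hI r hr.1, hI s hs.1]
  have hs2 : s ^ 2 < 6 * B / (C + 1) := (Real.lt_sqrt hs.1.le).1 hs.2
  rw [lt_div_iff₀ (by positivity)] at hs2
  have h1 : r ^ 2 < s ^ 2 := pow_lt_pow_left₀ hrs hr.1.le (by norm_num)
  have h2 : C * r ^ 2 ≤ C * s ^ 2 := by gcongr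
  have h3 : C * s ^ 2 < 6 * B := by nlinarith [sq_nonneg s]
  have h4 : 0 < (s ^ 2 - r ^ 2) * (12 * B - C * s ^ 2 - C * r ^ 2) :=
    mul_pos (by linarith) (by linarith)
  nlinarith
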